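/- Let $1 \le q \le p \le \infty$ and $f \in L^q_{uloc}(\mathbb{R}^3)$. Then for all $t > 0$, $\|e^{t\Delta} f\|_{L^p_{uloc}} \le C\left(1 + t^{-\frac{3}{2}(\frac1q - \frac1p)}\right) \|f\|_{L^q_{uloc}}$ with $C$ depending only on $p,q$. -/

import Mathlib

open MeasureTheory Metric Real ENNReal

noncomputable section

/-- The Gaussian heat kernel on `ℝ³`. -/
def heatKernel (t : ℝ) (x : EuclideanSpace ℝ (Fin 3)) : ℝ :=
  (4 * π * t) ^ (-(3 : ℝ) / 2) * Real.exp (-‖x‖ ^ 2 / (4 * t))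

/-- The heat kernel has total mass one. -/
lemma lintegral_heatKernel {t : ℝ} (ht : 0 < t) :
    ∫⁻ x, ENNReal.ofReal (heatKernel t x) = 1 := by
  have hb : 0 < 1 / (4 * t) := by positivity
  have hI := GaussianFourier.integral_rexp_neg_mul_sq_norm
    (V := EuclideanSpace ℝ (Fin 3)) hb
  have hK : ∀ x : EuclideanSpace ℝ (Fin 3), heatKernel t x =
      (4 * π * t) ^ (-(3 : ℝ) / 2) * Real.exp (-(1 / (4 * t)) * ‖x‖ ^ 2) := by
    intro x
    rw [heatKernel]
    congr 2
    ring
  have hone : ∫ x, heatKernel t x = 1 := by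
    simp_rw [hK]
    rw [integral_const_mul, hI]
    have h1 : π / (1 / (4 * t)) = 4 * π * t := by field_simp
    rw [h1, finrank_euclideanSpace_fin, ← Real.rpow_add (by positivity)]
    norm_num
  have hint : Integrable (heatKernel t) := Integrable.of_integral_ne_zero (by simp [hone])
  rw [← ofReal_integral_eq_lintegral_ofReal hint, hone, ENNReal.ofReal_one]
  exact Filter.Eventually.of_forall fun x => by
    simp only [Pi.zero_apply, heatKernel]
    positivity

lemma heatKernel_nonneg {t : ℝ} (ht : 0 < t) (x : EuclideanSpace ℝ (Fin 3)) :
    0 ≤ heatKernel t x := by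
  rw [heatKernel]
  positivity

lemma measurable_ofReal_heatKernel (t : ℝ) :
    Measurable fun x => ENNReal.ofReal (heatKernel t x) := by
  unfold heatKernel
  fun_prop

/-- The heat kernels at times `t` and `2t` are comparable at points at distance at most `√t`. -/
lemma heatKernel_le_of_norm_sub_le {t : ℝ} (ht : 0 < t) {v w : EuclideanSpace ℝ (Fin 3)}
    (hvw : ‖w - v‖ ≤ √t) : heatKernel t v ≤ 12 * heatKernel (2 * t) w := by
  have hsq : ‖w‖ ^ 2 ≤ 2 * ‖v‖ ^ 2 + 2 * t := by
    have h1 : ‖w‖ ≤ ‖v‖ + √t := by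
      have := norm_le_norm_add_norm_sub v w
      rw [norm_sub_rev] at hvw
      linarith
    have h2 := Real.sq_sqrt ht.le
    nlinarith [norm_nonneg w, norm_nonneg v, Real.sqrt_nonneg t, sq_nonneg (‖v‖ - √t)]
  have hexp : Real.exp (-‖v‖ ^ 2 / (4 * t)) ≤ 3 * Real.exp (-‖w‖ ^ 2 / (4 * (2 * t))) := by
    have h1 : -‖v‖ ^ 2 / (4 * t) ≤ 1 + -‖w‖ ^ 2 / (4 * (2 * t)) := by
      rw [div_le_iff₀ (by positivity)]
      have : (1 + -‖w‖ ^ 2 / (4 * (2 * t))) * (4 * t) = 4 * t - ‖w‖ ^ 2 / 2 := by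
        field_simp
        ring
      rw [this]
      linarith
    calc _ ≤ _ := Real.exp_le_exp.2 h1
      _ = Real.exp 1 * Real.exp (-‖w‖ ^ 2 / (4 * (2 * t))) := Real.exp_add _ _
      _ ≤ _ := by
        gcongr
        linarith [Real.exp_one_lt_d9]
  have hpow : (4 * π * t) ^ (-(3 : ℝ) / 2) ≤ 4 * (4 * π * (2 * t)) ^ (-(3 : ℝ) / 2) := by
    have h1 : 4 * π * (2 * t) = 2 * (4 * π * t) := by ring
    rw [h1, Real.mul_rpow (x := 2) (y := 4 * π * t) (by norm_num) (by positivity), ← mul_assoc]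
    refine le_mul_of_one_le_left (by positivity) ?_
    have h2 : (2 : ℝ) ^ (-2 : ℝ) ≤ 2 ^ (-(3 : ℝ) / 2) :=
      Real.rpow_le_rpow_of_exponent_le (by norm_num) (by norm_num)
    have h3 : (2 : ℝ) ^ (-2 : ℝ) = 1 / 4 := by
      rw [Real.rpow_neg (by norm_num)]
      norm_num
    linarith
  calc heatKernel t v ≤ (4 * (4 * π * (2 * t)) ^ (-(3 : ℝ) / 2)) *
        (3 * Real.exp (-‖w‖ ^ 2 / (4 * (2 * t)))) := by
        rw [heatKernel]
        gcongr
    _ = 12 * heatKernel (2 * t) w := by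
        rw [heatKernel]
        ring

/-- The heat flow is bounded on `L¹_uloc`. -/
lemma lintegral_ball_heatflow_le {t : ℝ} (ht : 0 < t)
    {G : EuclideanSpace ℝ (Fin 3) → ℝ≥0∞} (hG : AEMeasurable G) {N : ℝ≥0∞}
    (hN : ∀ z, ∫⁻ y in ball z 1, G y ≤ N) (x0 : EuclideanSpace ℝ (Fin 3)) :
    ∫⁻ x in ball x0 1, ∫⁻ y, ENNReal.ofReal (heatKernel t (x - y)) * G y ≤ N := by
  have hsub : ∀ x, ∫⁻ y, ENNReal.ofReal (heatKernel t (x - y)) * G y =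
      ∫⁻ z, ENNReal.ofReal (heatKernel t z) * G (x - z) := fun x => by
    rw [← lintegral_sub_left_eq_self _ x]
    simp
  have hmeas : AEMeasurable (Function.uncurry fun x z : EuclideanSpace ℝ (Fin 3) =>
      ENNReal.ofReal (heatKernel t z) * G (x - z))
      ((volume.restrict (ball x0 1)).prod volume) := by
    refine AEMeasurable.mul ((measurable_ofReal_heatKernel t).comp measurable_snd).aemeasurable ?_
    exact (hG.comp_quasiMeasurePreserving (quasiMeasurePreserving_sub volume volume)).mono_ac
      (Measure.AbsolutelyContinuous.prod Measure.restrict_le_self.absolutelyContinuous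
        Measure.AbsolutelyContinuous.rfl)
  simp_rw [hsub]
  rw [lintegral_lintegral_swap hmeas]
  have htrans : ∀ z, ∫⁻ x in ball x0 1, G (x - z) = ∫⁻ y in ball (x0 - z) 1, G y := fun z => by
    have hpre : (fun x => x - z) ⁻¹' ball (x0 - z) 1 = ball x0 1 := by
      ext x
      simp
    rw [← (measurePreserving_sub_right volume z).setLIntegral_comp_preimage_emb
      (MeasurableEquiv.subRight z).measurableEmbedding G, hpre]
  calc ∫⁻ z, ∫⁻ x in ball x0 1, ENNReal.ofReal (heatKernel t z) * G (x - z)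
      = ∫⁻ z, ENNReal.ofReal (heatKernel t z) * ∫⁻ y in ball (x0 - z) 1, G y := by
        refine lintegral_congr fun z => ?_
        rw [lintegral_const_mul' _ _ ENNReal.ofReal_ne_top, htrans]
    _ ≤ ∫⁻ z, ENNReal.ofReal (heatKernel t z) * N := by
        gcongr
        exact hN _
    _ = N := by
        rw [lintegral_mul_const _ (measurable_ofReal_heatKernel t), lintegral_heatKernel ht,
          one_mul]

/-- The heat flow maps `L¹_uloc` to `L^∞`. -/
lemma exists_heatflow_le : ∃ C : ℝ, 1 ≤ C ∧ ∀ t : ℝ, 0 < t →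
    ∀ G : EuclideanSpace ℝ (Fin 3) → ℝ≥0∞, AEMeasurable G → ∀ N : ℝ≥0∞,
    (∀ z, ∫⁻ y in ball z 1, G y ≤ N) → ∀ x,
    ∫⁻ y, ENNReal.ofReal (heatKernel t (x - y)) * G y ≤
      ENNReal.ofReal (C * (1 + t ^ (-(3 / 2 : ℝ)))) * N := by
  set V : ℝ≥0∞ := volume (ball (0 : EuclideanSpace ℝ (Fin 3)) 1) with hV
  have hV0 : 0 < V := measure_ball_pos _ _ one_pos
  have hVt : V ≠ ⊤ := measure_ball_lt_top.ne
  have hVr : 0 < V.toReal := ENNReal.toReal_pos hV0.ne' hVt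
  refine ⟨max 1 (12 / V.toReal), le_max_left _ _, fun t ht G hG N hN x => ?_⟩
  set S : ℝ≥0∞ := ∫⁻ y, ENNReal.ofReal (heatKernel t (x - y)) * G y
  set ρ : ℝ := min 1 √t with hρ
  have hρ0 : 0 < ρ := lt_min one_pos (Real.sqrt_pos.2 ht)
  have hball : volume (ball x ρ) = ENNReal.ofReal (ρ ^ 3 * V.toReal) := by
    rw [Measure.addHaar_ball _ _ hρ0.le, finrank_euclideanSpace_fin,
      ENNReal.ofReal_mul (by positivity), ENNReal.ofReal_toReal hVt]
  have hharnack : ∀ x' ∈ ball x ρ,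
      S ≤ 12 * ∫⁻ y, ENNReal.ofReal (heatKernel (2 * t) (x' - y)) * G y := by
    intro x' hx'
    rw [← lintegral_const_mul' _ _ (by norm_num)]
    refine lintegral_mono fun y => ?_
    rw [← mul_assoc]
    gcongr
    rw [show (12 : ℝ≥0∞) = ENNReal.ofReal 12 by norm_num, ← ENNReal.ofReal_mul (by norm_num)]
    refine ENNReal.ofReal_le_ofReal (heatKernel_le_of_norm_sub_le ht ?_)
    rw [sub_sub_sub_cancel_right, ← dist_eq_norm]
    exact (mem_ball.1 hx').le.trans (min_le_right _ _)
  have hmul : ENNReal.ofReal (ρ ^ 3 * V.toReal) * S ≤ ENNReal.ofReal 12 * N := by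
    calc ENNReal.ofReal (ρ ^ 3 * V.toReal) * S = ∫⁻ _ in ball x ρ, S := by
          rw [setLIntegral_const, hball, mul_comm]
      _ ≤ ∫⁻ x' in ball x ρ,
          12 * ∫⁻ y, ENNReal.ofReal (heatKernel (2 * t) (x' - y)) * G y :=
          setLIntegral_mono' measurableSet_ball hharnack
      _ ≤ ∫⁻ x' in ball x 1,
          12 * ∫⁻ y, ENNReal.ofReal (heatKernel (2 * t) (x' - y)) * G y :=
          lintegral_mono_set (ball_subset_ball (min_le_left _ _))
      _ ≤ ENNReal.ofReal 12 * N := by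
          rw [lintegral_const_mul' _ _ (by norm_num)]
          gcongr
          · norm_num
          · exact lintegral_ball_heatflow_le (by positivity) hG hN x
  have hρinv : (ρ ^ 3)⁻¹ ≤ 1 + t ^ (-(3 / 2 : ℝ)) := by
    have htp : 0 < t ^ (-(3 / 2 : ℝ)) := by positivity
    rcases min_choice 1 √t with h | h
    · rw [hρ, h]
      norm_num
      exact htp.le
    · have : (√t ^ 3)⁻¹ = t ^ (-(3 / 2 : ℝ)) := by
        rw [Real.rpow_neg ht.le, Real.sqrt_eq_rpow, ← Real.rpow_natCast, ← Real.rpow_mul ht.le]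
        norm_num
      rw [hρ, h, this]
      linarith
  rw [ENNReal.mul_le_iff_le_inv (by simp; positivity) ENNReal.ofReal_ne_top] at hmul
  refine hmul.trans ?_
  rw [← ENNReal.ofReal_inv_of_pos (by positivity), ← mul_assoc,
    ← ENNReal.ofReal_mul (by positivity)]
  refine mul_le_mul_left (ENNReal.ofReal_le_ofReal ?_) N
  calc (ρ ^ 3 * V.toReal)⁻¹ * 12 = 12 / V.toReal * (ρ ^ 3)⁻¹ := by
        rw [mul_inv]
        ring
    _ ≤ _ := by
        gcongr
        exact le_max_right _ _

/-- Jensen's inequality for the heat flow. -/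
lemma enorm_heatflow_le {t : ℝ} (ht : 0 < t) {q : ℝ≥0∞} (hq : 1 ≤ q)
    {f : EuclideanSpace ℝ (Fin 3) → ℝ} (hf : AEStronglyMeasurable f)
    (x : EuclideanSpace ℝ (Fin 3)) :
    ‖∫ y, heatKernel t (x - y) * f y‖ₑ ≤
      eLpNorm f q (volume.withDensity fun y => ENNReal.ofReal (heatKernel t (x - y))) := by
  have hm : Measurable fun y => ENNReal.ofReal (heatKernel t (x - y)) :=
    (measurable_ofReal_heatKernel t).comp (measurable_const.sub measurable_id)
  set μ := volume.withDensity fun y => ENNReal.ofReal (heatKernel t (x - y)) with hμ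
  have hprob : IsProbabilityMeasure μ := ⟨by
    rw [hμ, withDensity_apply _ MeasurableSet.univ, Measure.restrict_univ,
      lintegral_sub_left_eq_self (fun z => ENNReal.ofReal (heatKernel t z)),
      lintegral_heatKernel ht]⟩
  calc ‖∫ y, heatKernel t (x - y) * f y‖ₑ
      ≤ ∫⁻ y, ‖heatKernel t (x - y) * f y‖ₑ := enorm_integral_le_lintegral_enorm _
    _ = eLpNorm f 1 μ := by
      rw [eLpNorm_one_eq_lintegral_enorm, hμ,
        lintegral_withDensity_eq_lintegral_mul₀ hm.aemeasurable hf.enorm]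
      refine lintegral_congr fun y => ?_
      rw [enorm_mul, Real.enorm_eq_ofReal (heatKernel_nonneg ht _)]
      rfl
    _ ≤ eLpNorm f q μ := eLpNorm_le_eLpNorm_of_exponent_le hq
      (hf.mono_ac (withDensity_absolutelyContinuous _ _))

lemma eLpNorm_top_le_of_forall_ball {f : EuclideanSpace ℝ (Fin 3) → ℝ} {M : ℝ≥0∞}
    (hM : ∀ z, eLpNorm f ⊤ (volume.restrict (ball z 1)) ≤ M) : eLpNorm f ⊤ volume ≤ M := by
  rw [eLpNorm_exponent_top]
  refine eLpNormEssSup_le_of_ae_enorm_bound (measure_null_of_locally_null _ fun x _ => ?_)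
  refine ⟨_, inter_mem_nhdsWithin _ (ball_mem_nhds x one_pos), ?_⟩
  have h : ∀ᵐ y ∂volume.restrict (ball x 1), ‖f y‖ₑ ≤ M := by
    filter_upwards [enorm_ae_le_eLpNormEssSup f (volume.restrict (ball x 1))] with y hy
    exact hy.trans (by simpa using hM x)
  rw [ae_iff, Measure.restrict_apply' measurableSet_ball] at h
  exact h

/-- Interpolation between a uniform bound and an integral bound. -/
lemma eLpNorm_le_of_rpow_le {α : Type*} [MeasurableSpace α] {μ : Measure α} {p q : ℝ≥0∞}
    (hq : 1 ≤ q) (hqp : q ≤ p) (hqt : q ≠ ⊤) {u : α → ℝ} {S : α → ℝ≥0∞} {A N : ℝ≥0∞}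
    (hu : ∀ x, ‖u x‖ₑ ≤ S x ^ (1 / q.toReal)) (hS : ∀ x, S x ≤ A * N)
    (hA : A ≠ ⊤) (hN : N ≠ ⊤) (hint : ∫⁻ x, S x ∂μ ≤ N) :
    eLpNorm u p μ ≤ A ^ (1 / q.toReal - 1 / p.toReal) * N ^ (1 / q.toReal) := by
  have hq1 : 1 ≤ q.toReal := by
    rw [← ENNReal.toReal_one]
    exact ENNReal.toReal_mono hqt hq
  have hq0 : 0 < q.toReal := by linarith
  rcases eq_or_ne p ⊤ with rfl | hpt
  · rw [eLpNorm_exponent_top]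
    refine eLpNormEssSup_le_of_ae_enorm_bound (Filter.Eventually.of_forall fun x => ?_)
    rw [ENNReal.toReal_top, _root_.div_zero, _root_.sub_zero, ← ENNReal.mul_rpow_of_nonneg _ _ (by positivity)]
    exact (hu x).trans (ENNReal.rpow_le_rpow (hS x) (by positivity))
  have hpq : q.toReal ≤ p.toReal := ENNReal.toReal_mono hpt hqp
  have hp0 : 0 < p.toReal := by linarith
  set r : ℝ := p.toReal / q.toReal - 1 with hr
  have hr0 : 0 ≤ r := by
    rw [hr, sub_nonneg, le_div_iff₀ hq0]
    linarith
  have hpoint : ∀ x, ‖u x‖ₑ ^ p.toReal ≤ (A * N) ^ r * S x := by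
    intro x
    calc ‖u x‖ₑ ^ p.toReal ≤ (S x ^ (1 / q.toReal)) ^ p.toReal :=
          ENNReal.rpow_le_rpow (hu x) hp0.le
      _ = S x ^ r * S x := by
          rw [← ENNReal.rpow_mul]
          nth_rw 3 [← ENNReal.rpow_one (S x)]
          rw [← ENNReal.rpow_add_of_nonneg _ _ hr0 zero_le_one, hr]
          congr 1
          ring
      _ ≤ (A * N) ^ r * S x := by
          gcongr
          exact hS x
  have hp : p ≠ 0 := (zero_lt_one.trans_le (hq.trans hqp)).ne'
  rw [eLpNorm_eq_lintegral_rpow_enorm_toReal hp hpt]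
  calc (∫⁻ x, ‖u x‖ₑ ^ p.toReal ∂μ) ^ (1 / p.toReal)
      ≤ ((A * N) ^ r * N) ^ (1 / p.toReal) := by
        refine ENNReal.rpow_le_rpow ?_ (by positivity)
        calc _ ≤ ∫⁻ x, (A * N) ^ r * S x ∂μ := lintegral_mono hpoint
          _ = (A * N) ^ r * ∫⁻ x, S x ∂μ := lintegral_const_mul' _ _
              (ENNReal.rpow_ne_top_of_nonneg hr0 (ENNReal.mul_ne_top hA hN))
          _ ≤ _ := by gcongr
    _ = (A ^ r * N ^ (r + 1)) ^ (1 / p.toReal) := by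
        rw [ENNReal.mul_rpow_of_nonneg _ _ hr0, mul_assoc,
          ENNReal.rpow_add_of_nonneg _ _ hr0 zero_le_one, ENNReal.rpow_one]
    _ = _ := by
        rw [ENNReal.mul_rpow_of_nonneg _ _ (by positivity), ← ENNReal.rpow_mul,
          ← ENNReal.rpow_mul, hr]
        congr 2 <;> field_simp
        ring

/-- `L^q_uloc → L^p_uloc` smoothing estimate for the heat semigroup, `1 ≤ q ≤ p ≤ ∞`:
`‖e^{tΔ}f‖_{L^p_uloc} ≤ C (1 + t^{-(3/2)(1/q - 1/p)}) ‖f‖_{L^q_uloc}`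
(with the convention `1/∞ = 0`). -/
theorem heatflow_uloc_smoothing (p q : ℝ≥0∞) (hq : 1 ≤ q) (hqp : q ≤ p) :
    ∃ C : ℝ, 0 < C ∧
      ∀ (f : EuclideanSpace ℝ (Fin 3) → ℝ), LocallyIntegrable f volume →
      ∀ M : ℝ≥0∞, (∀ z : EuclideanSpace ℝ (Fin 3),
          eLpNorm f q (volume.restrict (ball z 1)) ≤ M) →
      ∀ t : ℝ, 0 < t → ∀ x0 : EuclideanSpace ℝ (Fin 3),
        eLpNorm (fun x => ∫ y, heatKernel t (x - y) * f y) p (volume.restrict (ball x0 1)) ≤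
          ENNReal.ofReal
            (C * (1 + t ^ (-(3 / 2 : ℝ) * (1 / q.toReal - 1 / p.toReal)))) * M := by
  obtain ⟨C, hC1, hC⟩ := exists_heatflow_le
  have hC0 : 0 < C := by linarith
  refine ⟨C, hC0, fun f hf M hM t ht x0 => ?_⟩
  have hfm : AEStronglyMeasurable f := hf.aestronglyMeasurable
  rcases eq_or_ne M ⊤ with rfl | hMt
  · rw [ENNReal.mul_top]
    · exact le_top
    · rw [Ne, ENNReal.ofReal_eq_zero, not_le]
      positivity
  rcases eq_or_ne q ⊤ with rfl | hqt
  · obtain rfl : p = ⊤ := top_le_iff.1 hqp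
    rw [eLpNorm_exponent_top]
    refine eLpNormEssSup_le_of_ae_enorm_bound (Filter.Eventually.of_forall fun x => ?_)
    calc _ ≤ _ := enorm_heatflow_le ht le_top hfm x
      _ ≤ eLpNorm f ⊤ volume := eLpNormEssSup_mono_measure _ (withDensity_absolutelyContinuous _ _)
      _ ≤ M := eLpNorm_top_le_of_forall_ball hM
      _ ≤ _ := by
        refine le_mul_of_one_le_left zero_le ?_
        rw [ENNReal.one_le_ofReal]
        simp
        linarith
  have hq1 : 1 ≤ q.toReal := by
    rw [← ENNReal.toReal_one]
    exact ENNReal.toReal_mono hqt hq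
  have hq0 : 0 < q.toReal := by linarith
  have hqz : q ≠ 0 := (zero_lt_one.trans_le hq).ne'
  have hGm : AEMeasurable fun y => ‖f y‖ₑ ^ q.toReal := hfm.enorm.pow_const _
  have hG : ∀ z, ∫⁻ y in ball z 1, ‖f y‖ₑ ^ q.toReal ≤ M ^ q.toReal := by
    intro z
    have h := hM z
    rw [eLpNorm_eq_lintegral_rpow_enorm_toReal hqz hqt, one_div,
      ENNReal.rpow_inv_le_iff hq0] at h
    exact h
  have hu : ∀ x, ‖∫ y, heatKernel t (x - y) * f y‖ₑ ≤
      (∫⁻ y, ENNReal.ofReal (heatKernel t (x - y)) * ‖f y‖ₑ ^ q.toReal) ^ (1 / q.toReal) := by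
    intro x
    refine (enorm_heatflow_le ht hq hfm x).trans_eq ?_
    rw [eLpNorm_eq_lintegral_rpow_enorm_toReal hqz hqt,
      lintegral_withDensity_eq_lintegral_mul₀ _ hGm]
    · rfl
    · exact ((measurable_ofReal_heatKernel t).comp
        (measurable_const.sub measurable_id)).aemeasurable
  refine (eLpNorm_le_of_rpow_le hq hqp hqt hu (hC t ht _ hGm _ hG) ENNReal.ofReal_ne_top
    (ENNReal.rpow_ne_top_of_nonneg hq0.le hMt)
    (lintegral_ball_heatflow_le ht hGm hG x0)).trans ?_
  rw [← ENNReal.rpow_mul, mul_one_div_cancel hq0.ne', ENNReal.rpow_one]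
  gcongr
  set a : ℝ := 1 / q.toReal - 1 / p.toReal with ha
  have ha0 : 0 ≤ a := by
    rw [ha, sub_nonneg]
    rcases eq_or_ne p ⊤ with rfl | hpt
    · simp
    · exact one_div_le_one_div_of_le hq0 (ENNReal.toReal_mono hpt hqp)
  have ha1 : a ≤ 1 := by
    have h1 : 1 / q.toReal ≤ 1 := (div_le_one hq0).2 hq1
    have h2 : 0 ≤ 1 / p.toReal := by positivity
    linarith
  rw [ENNReal.ofReal_rpow_of_nonneg (by positivity) ha0]
  refine ENNReal.ofReal_le_ofReal ?_
  rw [Real.mul_rpow hC0.le (by positivity), Real.rpow_mul ht.le]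
  gcongr
  · exact Real.rpow_le_self_of_one_le hC1 ha1
  · simpa using Real.rpow_add_le_add_rpow zero_le_one
      (by positivity : 0 ≤ t ^ (-(3 / 2 : ℝ))) ha0 ha1
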